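/- For a non-negative radial function u ∈ L¹(ℝ³), the Newtonian potential satisfies Newton's formula: ((-Δ)^{-1}u)(x) = (1/(4π|x|)) ∫_{|y| ≤ |x|} u(y) dy + ∫_{|y| ≥ |x|} u(y)/(4π|y|) dy, where (-Δ)^{-1}u(x) = (1/(4π)) ∫_{ℝ³} u(y)/|x-y| dy. -/

import Mathlib

open MeasureTheory Real

section

open Set ENNReal

theorem lintegral_comp_normSq_prod {h : ℝ → ℝ≥0∞} (hh : Measurable h) :
    ∫⁻ w : ℝ × ℝ, h (w.1 ^ 2 + w.2 ^ 2)
      = ENNReal.ofReal (2 * π) * ∫⁻ s in Ioi (0 : ℝ), ENNReal.ofReal s * h (s ^ 2) := by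
  rw [← lintegral_comp_polarCoord_symm]
  have key (p : ℝ × ℝ) : h ((polarCoord.symm p).1 ^ 2 + (polarCoord.symm p).2 ^ 2)
      = h (p.1 ^ 2) := by
    congr 1
    simp only [polarCoord_symm_apply]
    linear_combination p.1 ^ 2 * Real.cos_sq_add_sin_sq p.2
  simp only [key, smul_eq_mul, polarCoord_target]
  rw [Measure.volume_eq_prod, ← Measure.prod_restrict, lintegral_prod _ (by fun_prop)]
  simp only [lintegral_const, Measure.restrict_apply MeasurableSet.univ, univ_inter, volume_Ioo]
  rw [lintegral_mul_const _ (by fun_prop), mul_comm]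
  ring_nf

theorem lintegral_Ioi_mul_comp_sqrt_add_sq (z : ℝ) (H : ℝ → ℝ≥0∞) :
    ∫⁻ s in Ioi (0 : ℝ), ENNReal.ofReal s * H (√(z ^ 2 + s ^ 2))
      = ∫⁻ r in Ioi |z|, ENNReal.ofReal r * H r := by
  have himage : (fun s : ℝ ↦ √(z ^ 2 + s ^ 2)) '' Ioi 0 = Ioi |z| := by
    ext r
    constructor
    · rintro ⟨s, hs, rfl⟩
      have : 0 < s := hs
      exact Real.lt_sqrt_of_sq_lt (by rw [sq_abs]; nlinarith)
    · intro hr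
      have hr : |z| < r := hr
      have h0 := abs_nonneg z
      have hlt : 0 < r ^ 2 - z ^ 2 := by rw [← sq_abs z]; nlinarith
      refine ⟨√(r ^ 2 - z ^ 2), Real.sqrt_pos.2 hlt, ?_⟩
      simp only [Real.sq_sqrt hlt.le, add_sub_cancel]
      exact Real.sqrt_sq (h0.trans hr.le)
  have hinj : InjOn (fun s : ℝ ↦ √(z ^ 2 + s ^ 2)) (Ioi 0) := by
    intro a ha b hb hab
    have ha : 0 < a := ha
    have hb : 0 < b := hb
    have := (Real.sqrt_inj (by positivity) (by positivity)).1 hab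
    exact (sq_eq_sq₀ ha.le hb.le).1 (by linarith)
  have hderiv : ∀ s ∈ Ioi (0 : ℝ), HasDerivWithinAt (fun s : ℝ ↦ √(z ^ 2 + s ^ 2))
      (s / √(z ^ 2 + s ^ 2)) (Ioi 0) s := by
    intro s hs
    have hs : 0 < s := hs
    have := (((hasDerivAt_pow 2 s).const_add (z ^ 2)).sqrt (by positivity)).hasDerivWithinAt
      (s := Ioi 0)
    refine this.congr_deriv ?_
    rw [← mul_div_mul_left s _ two_ne_zero]
    simp
  rw [← himage, lintegral_image_eq_lintegral_abs_deriv_mul measurableSet_Ioi hderiv hinj]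
  refine setLIntegral_congr_fun measurableSet_Ioi fun s hs ↦ ?_
  have hs : 0 < s := hs
  have hpos : 0 < √(z ^ 2 + s ^ 2) := Real.sqrt_pos.2 (by positivity)
  rw [← mul_assoc, ← ENNReal.ofReal_mul (abs_nonneg _), abs_of_pos (by positivity),
    div_mul_cancel₀ _ hpos.ne']

/-- Archimedes' hat-box theorem, integrated over all radii. -/
theorem lintegral_comp_norm_apply_zero {F : ℝ → ℝ → ℝ≥0∞}
    (hF : Measurable (Function.uncurry F)) :
    ∫⁻ y : EuclideanSpace ℝ (Fin 3), F ‖y‖ (y 0)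
      = ENNReal.ofReal (2 * π) *
        ∫⁻ r in Ioi (0 : ℝ), ENNReal.ofReal r * ∫⁻ t in Ioo (-r) r, F r t := by
  let G : ℝ × ℝ × ℝ → ℝ≥0∞ := fun p ↦ F (√(p.1 ^ 2 + (p.2.1 ^ 2 + p.2.2 ^ 2))) p.1
  have hG : Measurable G :=
    hF.comp (Measurable.prodMk (by fun_prop) (by fun_prop))
  have hcoord : ∫⁻ y : EuclideanSpace ℝ (Fin 3), F ‖y‖ (y 0) = ∫⁻ p, G p := by
    have e : MeasurePreserving (fun y : EuclideanSpace ℝ (Fin 3) ↦ (y 0, y 1, y 2)) :=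
      ((MeasurePreserving.id volume).prod (volume_preserving_finTwoArrow ℝ)).comp
        ((volume_preserving_piFinSuccAbove (fun _ : Fin 3 ↦ ℝ) 0).comp
          (PiLp.volume_preserving_ofLp (Fin 3)))
    rw [← e.lintegral_comp hG]
    refine lintegral_congr fun y ↦ ?_
    simp [G, EuclideanSpace.norm_eq, Fin.sum_univ_three, add_assoc]
  have hslice (z : ℝ) : ∫⁻ w : ℝ × ℝ, G (z, w)
      = ENNReal.ofReal (2 * π) * ∫⁻ r in Ioi |z|, ENNReal.ofReal r * F r z := by
    rw [← lintegral_Ioi_mul_comp_sqrt_add_sq z (fun r ↦ F r z),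
      ← lintegral_comp_normSq_prod (h := fun q ↦ F (√(z ^ 2 + q)) z)]
    exact hF.comp (Measurable.prodMk (by fun_prop) (by fun_prop))
  have hS : MeasurableSet {p : ℝ × ℝ | |p.1| < p.2} :=
    measurableSet_lt (by fun_prop) (by fun_prop)
  have hK : Measurable ({p : ℝ × ℝ | |p.1| < p.2}.indicator
      fun p ↦ ENNReal.ofReal p.2 * F p.2 p.1) :=
    Measurable.indicator (Measurable.mul (by fun_prop)
      (hF.comp (Measurable.prodMk (by fun_prop) (by fun_prop)))) hS
  have hK' : Measurable fun z ↦ ∫⁻ r in Ioi |z|, ENNReal.ofReal r * F r z := by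
    simp_rw [← lintegral_indicator measurableSet_Ioi]
    exact hK.lintegral_prod_right'
  rw [hcoord, Measure.volume_eq_prod, lintegral_prod _ hG.aemeasurable]
  simp_rw [hslice]
  rw [lintegral_const_mul _ hK']
  congr 1
  simp_rw [← lintegral_indicator measurableSet_Ioi]
  rw [lintegral_lintegral_swap (f := fun z r ↦ (Ioi |z|).indicator
    (fun r ↦ ENNReal.ofReal r * F r z) r) hK.aemeasurable]
  refine lintegral_congr fun r ↦ ?_
  by_cases hr : 0 < r
  · have hFr : Measurable (F r) := hF.comp measurable_prodMk_left
    rw [indicator_of_mem (mem_Ioi.2 hr), ← lintegral_const_mul _ hFr,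
      ← lintegral_indicator measurableSet_Ioo]
    refine lintegral_congr fun z ↦ ?_
    simp [indicator, abs_lt]
  · rw [indicator_of_notMem (by simpa using hr)]
    refine (lintegral_congr fun z ↦ ?_).trans lintegral_zero
    exact indicator_of_notMem (fun h ↦ hr ((abs_nonneg z).trans_lt h)) _

theorem lintegral_inv_sqrt_Ioo {r R : ℝ} (hr : 0 < r) (hR : 0 < R) :
    ∫⁻ t in Ioo (-r) r, ENNReal.ofReal (1 / √(r ^ 2 + R ^ 2 - 2 * R * t))
      = ENNReal.ofReal (2 * r / max r R) := by
  have hle : -r ≤ r := by linarith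
  have hcont : ContinuousOn (fun t ↦ -√(r ^ 2 + R ^ 2 - 2 * R * t) / R) (Icc (-r) r) := by
    fun_prop
  have hderiv : ∀ t ∈ Ioo (-r) r, HasDerivAt (fun t ↦ -√(r ^ 2 + R ^ 2 - 2 * R * t) / R)
      (1 / √(r ^ 2 + R ^ 2 - 2 * R * t)) t := by
    intro t ht
    have hpos : 0 < r ^ 2 + R ^ 2 - 2 * R * t := by
      nlinarith [sq_nonneg (r - R), mul_pos hR (sub_pos.2 ht.2)]
    have := (((((hasDerivAt_id t).const_mul (2 * R)).const_sub (r ^ 2 + R ^ 2)).sqrt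
      hpos.ne').neg).div_const R
    refine this.congr_deriv ?_
    simp only [id]
    field_simp
  have hnn : ∀ t, 0 ≤ 1 / √(r ^ 2 + R ^ 2 - 2 * R * t) := fun t ↦ by positivity
  have hint := intervalIntegral.integrableOn_deriv_of_nonneg hcont hderiv fun t _ ↦ hnn t
  rw [setLIntegral_congr Ioo_ae_eq_Ioc,
    ← ofReal_integral_eq_lintegral_ofReal hint (.of_forall hnn),
    ← intervalIntegral.integral_of_le hle,
    intervalIntegral.integral_eq_sub_of_hasDerivAt_of_le hle hcont hderiv
      ((intervalIntegrable_iff_integrableOn_Ioc_of_le hle).2 hint)]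
  congr 1
  rw [show r ^ 2 + R ^ 2 - 2 * R * r = (r - R) ^ 2 by ring,
    show r ^ 2 + R ^ 2 - 2 * R * -r = (r + R) ^ 2 by ring, Real.sqrt_sq_eq_abs,
    Real.sqrt_sq (by positivity)]
  rcases le_total r R with h | h
  · rw [max_eq_right h, abs_of_nonpos (by linarith)]
    field_simp
    ring
  · rw [max_eq_left h, abs_of_nonneg (by linarith)]
    field_simp
    ring

/-- The spherical averages of `1 / ‖x - y‖` and of `1 / max ‖y‖ ‖x‖` agree, so these kernels have
the same integral against a radial density. -/
theorem lintegral_radial_mul_inv_norm_sub {g : ℝ → ℝ≥0∞} (hg : Measurable g)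
    {x : EuclideanSpace ℝ (Fin 3)} (hx : x ≠ 0) :
    ∫⁻ y, g ‖y‖ * ENNReal.ofReal (1 / ‖x - y‖)
      = ∫⁻ y : EuclideanSpace ℝ (Fin 3), g ‖y‖ * ENNReal.ofReal (1 / max ‖y‖ ‖x‖) := by
  have hR : 0 < ‖x‖ := norm_pos_iff.2 hx
  set R := ‖x‖
  let p : EuclideanSpace ℝ (Fin 3) := EuclideanSpace.single 0 R
  have hp : ‖p‖ = ‖x‖ := by simp [p, R]
  let ρ : EuclideanSpace ℝ (Fin 3) ≃ₗᵢ[ℝ] EuclideanSpace ℝ (Fin 3) :=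
    (Submodule.span ℝ {p - x})ᗮ.reflection
  have hρ : ρ p = x := Submodule.reflection_sub hp
  have hdist (y : EuclideanSpace ℝ (Fin 3)) :
      ‖x - ρ y‖ = √(‖y‖ ^ 2 + R ^ 2 - 2 * R * y 0) := by
    rw [← hρ, ← map_sub, ρ.norm_map, ← Real.sqrt_sq (norm_nonneg (p - y)), norm_sub_sq_real, hp]
    simp only [p, EuclideanSpace.inner_single_left, conj_trivial]
    congr 1
    ring
  rw [← ρ.measurePreserving.lintegral_comp (by fun_prop)]
  simp only [ρ.norm_map, hdist]
  rw [lintegral_comp_norm_apply_zero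
    (F := fun r t ↦ g r * ENNReal.ofReal (1 / √(r ^ 2 + R ^ 2 - 2 * R * t)))
      (by simp only [Function.uncurry_def]; fun_prop),
    lintegral_comp_norm_apply_zero (F := fun r _ ↦ g r * ENNReal.ofReal (1 / max r R))
      (by simp only [Function.uncurry_def]; fun_prop)]
  congr 1
  refine setLIntegral_congr_fun measurableSet_Ioi fun r hr ↦ ?_
  have hr : 0 < r := hr
  rw [lintegral_const_mul _ (by fun_prop), lintegral_inv_sqrt_Ioo hr hR, lintegral_const,
    Measure.restrict_apply MeasurableSet.univ, univ_inter, volume_Ioo, mul_assoc (g r),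
    ← ENNReal.ofReal_mul (by positivity)]
  congr 3
  ring

theorem ae_norm_of_ae_Ioi {P : ℝ → Prop} (hP : ∀ᵐ r ∂volume.restrict (Ioi (0 : ℝ)), P r) :
    ∀ᵐ y : EuclideanSpace ℝ (Fin 3), P ‖y‖ := by
  obtain ⟨N, hPN, hN, hN0⟩ := exists_measurable_superset_of_null (ae_iff.1 hP)
  refine measure_mono_null (t := (fun y ↦ ‖y‖) ⁻¹' N) (fun y hy ↦ hPN hy) ?_
  rw [← lintegral_indicator_one (measurable_norm hN)]
  refine (lintegral_comp_norm_apply_zero (F := fun r _ ↦ N.indicator 1 r) ?_).trans ?_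
  · exact (measurable_one.indicator hN).comp measurable_fst
  · rw [mul_eq_zero]
    right
    refine (lintegral_congr_ae ?_).trans lintegral_zero
    have : ∀ᵐ r ∂volume.restrict (Ioi (0 : ℝ)), r ∉ N := by
      rw [ae_iff]; simpa using hN0
    filter_upwards [this] with r hr
    simp [hr]

theorem exists_measurable_ofReal_eq_comp_norm {u : EuclideanSpace ℝ (Fin 3) → ℝ}
    (hrad : ∀ x y : EuclideanSpace ℝ (Fin 3), ‖x‖ = ‖y‖ → u x = u y) (hint : Integrable u) :
    ∃ g : ℝ → ℝ≥0∞, Measurable g ∧ ∀ᵐ y, ENNReal.ofReal (u y) = g ‖y‖ := by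
  let f : ℝ → ℝ := fun r ↦ u (EuclideanSpace.single 0 r)
  have huf : u = fun y ↦ f ‖y‖ := funext fun y ↦ hrad _ _ (by simp)
  rw [huf, integrable_fun_norm_addHaar] at hint
  have hint' : AEMeasurable (fun r : ℝ ↦ r ^ 2 * f r) (volume.restrict (Ioi 0)) := by
    simpa using hint.aestronglyMeasurable.aemeasurable
  have hf : AEMeasurable f (volume.restrict (Ioi 0)) := by
    refine (AEMeasurable.mul (f := fun r : ℝ ↦ (r ^ 2)⁻¹) (by fun_prop) hint').congr ?_
    filter_upwards [ae_restrict_mem measurableSet_Ioi] with r hr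
    have hr : 0 < r := hr
    simp only [Pi.mul_apply]
    field_simp
  refine ⟨fun r ↦ ENNReal.ofReal (hf.mk f r), hf.measurable_mk.ennreal_ofReal, ?_⟩
  filter_upwards [ae_norm_of_ae_Ioi hf.ae_eq_mk] with y hy
  rw [← hy, huf]

end

/-- Newton's formula for radial functions in three dimensions: the Newtonian
potential `(1/(4π)) ∫ u(y)/|x-y| dy` splits according to `|y| ≤ |x|` or `|y| ≥ |x|`. -/
theorem newton_formula_radial
    (u : EuclideanSpace ℝ (Fin 3) → ℝ)
    (hnonneg : ∀ x, 0 ≤ u x)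
    (hrad : ∀ x y : EuclideanSpace ℝ (Fin 3), ‖x‖ = ‖y‖ → u x = u y)
    (hint : Integrable u) :
    ∀ x : EuclideanSpace ℝ (Fin 3), x ≠ 0 →
      (1 / (4 * Real.pi)) * ∫ y, u y / ‖x - y‖
        = (1 / (4 * Real.pi * ‖x‖)) * (∫ y in {y : EuclideanSpace ℝ (Fin 3) | ‖y‖ ≤ ‖x‖}, u y)
          + ∫ y in {y : EuclideanSpace ℝ (Fin 3) | ‖x‖ ≤ ‖y‖}, u y / (4 * Real.pi * ‖y‖) := by
  intro x hx
  have hR : 0 < ‖x‖ := norm_pos_iff.2 hx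
  have hmax : Measurable fun y : EuclideanSpace ℝ (Fin 3) ↦ max ‖y‖ ‖x‖ := by fun_prop
  have hum := hint.aestronglyMeasurable.aemeasurable
  have hpotential : ∫ y, u y / ‖x - y‖ = ∫ y, u y / max ‖y‖ ‖x‖ := by
    obtain ⟨g, hg, hug⟩ := exists_measurable_ofReal_eq_comp_norm hrad hint
    have hlint (k : EuclideanSpace ℝ (Fin 3) → ℝ) : ∫⁻ y, ENNReal.ofReal (u y / k y)
        = ∫⁻ y, g ‖y‖ * ENNReal.ofReal (1 / k y) := by
      refine lintegral_congr_ae ?_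
      filter_upwards [hug] with y hy
      rw [← hy, ← ENNReal.ofReal_mul (hnonneg y), mul_one_div]
    rw [integral_eq_lintegral_of_nonneg_ae
        (.of_forall fun y ↦ div_nonneg (hnonneg y) (by positivity))
        (hum.div (by fun_prop)).aestronglyMeasurable,
      integral_eq_lintegral_of_nonneg_ae
        (.of_forall fun y ↦ div_nonneg (hnonneg y) (by positivity))
        (hum.div (by fun_prop)).aestronglyMeasurable,
      hlint, hlint, lintegral_radial_mul_inv_norm_sub hg hx]
  have hdiv : Integrable fun y ↦ u y / max ‖y‖ ‖x‖ := by
    refine (hint.div_const ‖x‖).mono' (hum.div hmax.aemeasurable).aestronglyMeasurable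
      (.of_forall fun y ↦ ?_)
    rw [Real.norm_of_nonneg (div_nonneg (hnonneg y) (by positivity))]
    exact div_le_div_of_nonneg_left (hnonneg y) hR (le_max_right _ _)
  have hA : MeasurableSet {y : EuclideanSpace ℝ (Fin 3) | ‖y‖ ≤ ‖x‖} :=
    measurableSet_le (by fun_prop) (by fun_prop)
  have hB : MeasurableSet {y : EuclideanSpace ℝ (Fin 3) | ‖x‖ ≤ ‖y‖} :=
    measurableSet_le (by fun_prop) (by fun_prop)
  have hcompl : ({y : EuclideanSpace ℝ (Fin 3) | ‖y‖ ≤ ‖x‖}ᶜ : Set _)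
      =ᵐ[volume] {y : EuclideanSpace ℝ (Fin 3) | ‖x‖ ≤ ‖y‖} := by
    have hsphere : ∀ᵐ y : EuclideanSpace ℝ (Fin 3), y ∉ Metric.sphere 0 ‖x‖ :=
      measure_eq_zero_iff_ae_notMem.1 (Measure.addHaar_sphere volume 0 ‖x‖)
    filter_upwards [hsphere] with y hy
    have hne : ‖x‖ ≠ ‖y‖ := fun h ↦ hy (by simp [h])
    exact propext (not_le.trans hne.le_iff_lt.symm)
  rw [hpotential, ← integral_add_compl hA hdiv, setIntegral_congr_set hcompl, mul_add,
    ← integral_const_mul, ← integral_const_mul, ← integral_const_mul]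
  congr 1
  · refine setIntegral_congr_fun hA fun y hy ↦ ?_
    simp only [max_eq_right (show ‖y‖ ≤ ‖x‖ from hy)]
    field_simp
  · refine setIntegral_congr_fun hB fun y hy ↦ ?_
    simp only [max_eq_left (show ‖x‖ ≤ ‖y‖ from hy)]
    field_simp
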